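/- (Induction step) Let n ≥ 2 and β > 1 with β ≠ 2,...,n. Then there is C(n,β) such that for a_1 ≥ ... ≥ a_{n+1} > 0 with a_1/a_2 ≥ √2, S(β; a_1,...,a_{n+1}) ≤ C(n,β)·max{ a_1^{−1} a_2^{−β+1}, a_1^{−1}·S(β−1; a_2,...,a_{n+1}) }, where S(β; a_1,...,a_{n+1}) is the n-fold first-octant spherical integral and S(β−1; a_2,...,a_{n+1}) is the analogous (n−1)-fold integral in one dimension lower. -/

import Mathlib

open Real MeasureTheory Set

/-- `S β a` is the spherical-coordinates expression for the integral over the first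
octant of `S^n` of the `β`-th power of the radial function of the rhombus with
vertices `±(1/aᵢ)eᵢ`:
`S(β; a₁,…,a_{n+1}) = ∫_{[0,π/2]^n} sin^{n−1}θ₁ ⋯ sin θ_{n−1}
  / (a₁ cos θ₁ + a₂ sin θ₁ cos θ₂ + ⋯ + a_{n+1} sin θ₁ ⋯ sin θ_n)^β dθ₁⋯dθ_n`. -/
noncomputable def S (n : ℕ) (β : ℝ) (a : Fin (n+1) → ℝ) : ℝ :=
  ∫ θ in Set.univ.pi (fun _ : Fin n => Set.Icc 0 (π/2)),
    (∏ j : Fin n, Real.sin (θ j) ^ (n - 1 - (j : ℕ))) /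
      (∑ i : Fin (n+1),
        a i * (∏ j : Fin n, if (j : ℕ) < (i : ℕ) then Real.sin (θ j) else 1) *
          (if h : (i : ℕ) < n then Real.cos (θ ⟨i, h⟩) else 1)) ^ β

/-- The box `[0, π/2]^n` of angles of the first octant of the sphere. -/
def octantBox (n : ℕ) : Set (Fin n → ℝ) := Set.univ.pi fun _ => Set.Icc 0 (π / 2)

/-- The spherical volume density `sin^{n-1}θ₁ ⋯ sin θ_{n-1}`. -/
noncomputable def sphereDensity (n : ℕ) (θ : Fin n → ℝ) : ℝ :=
  ∏ j : Fin n, Real.sin (θ j) ^ (n - 1 - (j : ℕ))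

/-- The linear form `∑ aᵢ xᵢ` evaluated at the point of the sphere with angles `θ`. -/
noncomputable def sphereForm (n : ℕ) (a : Fin (n + 1) → ℝ) (θ : Fin n → ℝ) : ℝ :=
  ∑ i : Fin (n + 1),
    a i * (∏ j : Fin n, if (j : ℕ) < (i : ℕ) then Real.sin (θ j) else 1) *
      (if h : (i : ℕ) < n then Real.cos (θ ⟨i, h⟩) else 1)

theorem S_eq (n : ℕ) (β : ℝ) (a : Fin (n + 1) → ℝ) :
    S n β a = ∫ θ in octantBox n, sphereDensity n θ / sphereForm n a θ ^ β := rfl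

theorem isCompact_octantBox (n : ℕ) : IsCompact (octantBox n) :=
  isCompact_univ_pi fun _ => isCompact_Icc

theorem measurableSet_octantBox (n : ℕ) : MeasurableSet (octantBox n) :=
  (isCompact_octantBox n).measurableSet

theorem sin_nonneg_of_mem_Icc_zero_pi_div_two {t : ℝ} (ht : t ∈ Icc 0 (π / 2)) : 0 ≤ sin t :=
  sin_nonneg_of_nonneg_of_le_pi ht.1 (by linarith [ht.2, pi_pos])

theorem cos_nonneg_of_mem_Icc_zero_pi_div_two {t : ℝ} (ht : t ∈ Icc 0 (π / 2)) : 0 ≤ cos t :=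
  cos_nonneg_of_neg_pi_div_two_le_of_le (by linarith [ht.1, pi_pos]) ht.2

theorem mul_cos_add_mul_sin_pos {A T t : ℝ} (hA : 0 < A) (hT : 0 < T) (ht : t ∈ Icc 0 (π / 2)) :
    0 < A * cos t + T * sin t := by
  have hs := sin_nonneg_of_mem_Icc_zero_pi_div_two ht
  have hc := cos_nonneg_of_mem_Icc_zero_pi_div_two ht
  rcases hs.lt_or_eq with h | h
  · positivity
  · rcases hc.lt_or_eq with h' | h'
    · positivity
    · have := sin_sq_add_cos_sq t
      simp [← h, ← h'] at this

theorem sphereDensity_cons (n : ℕ) (t : ℝ) (φ : Fin n → ℝ) :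
    sphereDensity (n + 1) (Fin.cons t φ) = sin t ^ n * sphereDensity n φ := by
  simp only [sphereDensity, Fin.prod_univ_succ, Fin.cons_zero, Fin.cons_succ]
  congr 1
  refine Finset.prod_congr rfl fun j _ => ?_
  congr 1
  simp only [Fin.val_succ]
  omega

theorem sphereForm_cons (n : ℕ) (a : Fin (n + 2) → ℝ) (t : ℝ) (φ : Fin n → ℝ) :
    sphereForm (n + 1) a (Fin.cons t φ) =
      a 0 * cos t + sphereForm n (fun i => a i.succ) φ * sin t := by
  rw [sphereForm, Fin.sum_univ_succ]
  congr 1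
  · simp
  · rw [sphereForm, Finset.sum_mul]
    refine Finset.sum_congr rfl fun i _ => ?_
    have hdite : (if h : (i.succ : ℕ) < n + 1
          then cos ((Fin.cons t φ : Fin (n + 1) → ℝ) ⟨i.succ, h⟩) else 1) =
        if h : (i : ℕ) < n then cos (φ ⟨i, h⟩) else 1 := by
      by_cases h : (i : ℕ) < n
      · have h' : (i.succ : ℕ) < n + 1 := by simpa using h
        rw [dif_pos h, dif_pos h']
        exact congrArg cos (Fin.cons_succ (α := fun _ => ℝ) t φ ⟨i, h⟩)
      · have h' : ¬ (i.succ : ℕ) < n + 1 := by simpa using h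
        rw [dif_neg h, dif_neg h']
    rw [hdite, Fin.prod_univ_succ]
    simp only [Fin.cons_zero, Fin.cons_succ, Fin.val_succ, Fin.val_zero, Nat.succ_pos, if_true,
      Nat.add_lt_add_iff_right]
    ring

theorem mem_octantBox_cons {n : ℕ} {t : ℝ} {φ : Fin n → ℝ} :
    (Fin.cons t φ : Fin (n + 1) → ℝ) ∈ octantBox (n + 1) ↔
      t ∈ Icc 0 (π / 2) ∧ φ ∈ octantBox n := by
  simp only [octantBox, mem_univ_pi, Fin.forall_fin_succ, Fin.cons_zero, Fin.cons_succ]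

theorem sphereForm_pos {n : ℕ} {a : Fin (n + 1) → ℝ} (ha : ∀ i, 0 < a i) {θ : Fin n → ℝ}
    (hθ : θ ∈ octantBox n) : 0 < sphereForm n a θ := by
  induction n with
  | zero => simpa [sphereForm] using ha 0
  | succ n ih =>
    obtain ⟨t, φ, rfl⟩ : ∃ t φ, θ = Fin.cons t φ := ⟨θ 0, Fin.tail θ, (Fin.cons_self_tail θ).symm⟩
    rw [mem_octantBox_cons] at hθ
    rw [sphereForm_cons]
    exact mul_cos_add_mul_sin_pos (ha 0) (ih (fun i => ha _) hθ.2) hθ.1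

theorem sphereDensity_nonneg {n : ℕ} {θ : Fin n → ℝ} (hθ : θ ∈ octantBox n) :
    0 ≤ sphereDensity n θ :=
  Finset.prod_nonneg fun j _ =>
    pow_nonneg (sin_nonneg_of_mem_Icc_zero_pi_div_two (hθ j (mem_univ j))) _

theorem continuous_sphereDensity (n : ℕ) : Continuous (sphereDensity n) := by
  unfold sphereDensity
  fun_prop

theorem continuous_sphereForm (n : ℕ) (a : Fin (n + 1) → ℝ) : Continuous (sphereForm n a) := by
  unfold sphereForm
  refine continuous_finsetSum _ fun i _ => (continuous_const.mul ?_).mul ?_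
  · refine continuous_finsetProd _ fun j _ => ?_
    split_ifs <;> fun_prop
  · split_ifs <;> fun_prop

theorem integrableOn_sphereDensity (n : ℕ) : IntegrableOn (sphereDensity n) (octantBox n) :=
  (continuous_sphereDensity n).continuousOn.integrableOn_compact (isCompact_octantBox n)

theorem integrableOn_sphereDensity_div {n : ℕ} {a : Fin (n + 1) → ℝ} (ha : ∀ i, 0 < a i) (β : ℝ) :
    IntegrableOn (fun θ => sphereDensity n θ / sphereForm n a θ ^ β) (octantBox n) := by
  refine ContinuousOn.integrableOn_compact (isCompact_octantBox n) ?_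
  refine (continuous_sphereDensity n).continuousOn.div ?_ fun θ hθ =>
    (rpow_pos_of_pos (sphereForm_pos ha hθ) β).ne'
  exact (continuous_sphereForm n a).continuousOn.rpow_const fun θ hθ =>
    Or.inl (sphereForm_pos ha hθ).ne'

/-- Fubini for the first angle; the integral over the remaining angles is the outer one. -/
theorem integrableOn_and_S_succ {n : ℕ} (β : ℝ) {a : Fin (n + 2) → ℝ} (ha : ∀ i, 0 < a i) :
    IntegrableOn (fun φ => ∫ t in Icc 0 (π / 2), sphereDensity n φ *
        (sin t ^ n / (a 0 * cos t + sphereForm n (fun i => a i.succ) φ * sin t) ^ β))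
        (octantBox n) ∧
    S (n + 1) β a = ∫ φ in octantBox n, ∫ t in Icc 0 (π / 2), sphereDensity n φ *
        (sin t ^ n / (a 0 * cos t + sphereForm n (fun i => a i.succ) φ * sin t) ^ β) := by
  have hmp := (volume_preserving_piFinSuccAbove (fun _ : Fin (n + 1) => ℝ) 0).symm
  set e := (MeasurableEquiv.piFinSuccAbove (fun _ : Fin (n + 1) => ℝ) 0).symm
  have he : ∀ p : ℝ × (Fin n → ℝ), e p = Fin.cons p.1 p.2 := fun p =>
    Fin.insertNth_zero' p.1 p.2
  have hpre : e ⁻¹' octantBox (n + 1) = Icc 0 (π / 2) ×ˢ octantBox n := by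
    ext p
    rw [mem_preimage, he, mem_octantBox_cons, mem_prod]
  have hF : ∀ p : ℝ × (Fin n → ℝ),
      sphereDensity (n + 1) (e p) / sphereForm (n + 1) a (e p) ^ β = sphereDensity n p.2 *
        (sin p.1 ^ n /
          (a 0 * cos p.1 + sphereForm n (fun i => a i.succ) p.2 * sin p.1) ^ β) := fun p => by
    rw [he, sphereDensity_cons, sphereForm_cons]
    ring
  have hint := (hmp.integrableOn_comp_preimage e.measurableEmbedding).2
    (integrableOn_sphereDensity_div ha β)
  have heq := hmp.setIntegral_preimage_emb e.measurableEmbedding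
    (fun θ => sphereDensity (n + 1) θ / sphereForm (n + 1) a θ ^ β) (octantBox (n + 1))
  rw [hpre] at hint heq
  simp only [Function.comp_def, hF] at hint heq
  rw [IntegrableOn, Measure.volume_eq_prod, ← Measure.prod_restrict] at hint
  rw [Measure.volume_eq_prod, ← Measure.prod_restrict, integral_prod_symm _ hint] at heq
  exact ⟨hint.integral_prod_right, by rw [S_eq, ← heq]⟩

theorem inv_rpow_mul_cos_add_mul_sin_le {A T t β : ℝ} (hA : 0 < A) (hT : 0 < T) (hβ : 0 ≤ β)
    (ht : t ∈ Icc 0 (π / 2)) :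
    ((A * cos t + T * sin t) ^ β)⁻¹ ≤
      2 ^ β * (A ^ (-β) + (A * (π / 2 - t) + T) ^ (-β)) := by
  have hs := sin_nonneg_of_mem_Icc_zero_pi_div_two ht
  have hc := cos_nonneg_of_mem_Icc_zero_pi_div_two ht
  have hD := mul_cos_add_mul_sin_pos hA hT ht
  have hsin : 2 / π * t ≤ sin t := mul_le_sin ht.1 ht.2
  have hcos : 2 / π * (π / 2 - t) ≤ cos t := by
    rw [← sin_pi_div_two_sub]
    exact mul_le_sin (by linarith [ht.2]) (by linarith [ht.1])
  have hu : 0 ≤ π / 2 - t := by linarith [ht.2]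
  have hE : 0 < A * (π / 2 - t) + T := by positivity
  have key : ∀ x : ℝ, 0 < x → x / 2 ≤ A * cos t + T * sin t →
      ((A * cos t + T * sin t) ^ β)⁻¹ ≤ 2 ^ β * x ^ (-β) := fun x hx h => by
    calc ((A * cos t + T * sin t) ^ β)⁻¹ ≤ ((x / 2) ^ β)⁻¹ := by gcongr
      _ = 2 ^ β * x ^ (-β) := by
        rw [div_rpow hx.le zero_le_two, rpow_neg hx.le, inv_div, div_eq_mul_inv]
  rcases le_total t (π / 4) with h | h
  · refine (key A hA ?_).trans ?_
    · have : 1 / 2 ≤ 2 / π * (π / 2 - t) := by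
        rw [div_mul_eq_mul_div, le_div_iff₀ pi_pos]
        linarith
      nlinarith [mul_nonneg hT.le hs]
    · gcongr
      linarith [rpow_nonneg hE.le (-β)]
  · refine (key _ hE ?_).trans ?_
    · have h1 : 1 / 2 ≤ 2 / π * t := by
        rw [div_mul_eq_mul_div, le_div_iff₀ pi_pos]
        linarith
      have h2 : (π / 2 - t) / 2 ≤ 2 / π * (π / 2 - t) := by
        rw [div_mul_eq_mul_div, le_div_iff₀ pi_pos]
        nlinarith [pi_le_four]
      nlinarith
    · gcongr
      linarith [rpow_nonneg hA.le (-β)]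

theorem integral_rpow_neg_le {A T β : ℝ} (hA : 0 < A) (hT : 0 < T) (hβ : 1 < β) :
    ∫ t in (0 : ℝ)..π / 2, (A * (π / 2 - t) + T) ^ (-β) ≤ (β - 1)⁻¹ * A⁻¹ * T ^ (1 - β) := by
  have hpos : ∀ t ∈ uIcc 0 (π / 2), 0 < A * (π / 2 - t) + T := fun t ht => by
    rw [uIcc_of_le (by positivity)] at ht
    have : 0 ≤ π / 2 - t := by linarith [ht.2]
    positivity
  have hderiv : ∀ t ∈ uIcc 0 (π / 2), HasDerivAt
      (fun t => (β - 1)⁻¹ * A⁻¹ * (A * (π / 2 - t) + T) ^ (1 - β))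
      ((A * (π / 2 - t) + T) ^ (-β)) t := fun t ht => by
    have h1 : HasDerivAt (fun t => A * (π / 2 - t) + T) (A * (-1)) t :=
      (((hasDerivAt_id t).const_sub (π / 2)).const_mul A).add_const T
    refine ((h1.rpow_const (p := 1 - β) (Or.inl (hpos t ht).ne')).const_mul
      ((β - 1)⁻¹ * A⁻¹)).congr_deriv ?_
    have : β - 1 ≠ 0 := by linarith
    rw [show 1 - β - 1 = -β by ring]
    field_simp
    ring
  have hcont : ContinuousOn (fun t => (A * (π / 2 - t) + T) ^ (-β)) (uIcc 0 (π / 2)) :=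
    ContinuousOn.rpow_const (by fun_prop) fun t ht => Or.inl (hpos t ht).ne'
  rw [intervalIntegral.integral_eq_sub_of_hasDerivAt hderiv hcont.intervalIntegrable]
  have : 0 ≤ (β - 1)⁻¹ * A⁻¹ * (A * (π / 2 - 0) + T) ^ (1 - β) := by
    have : 0 < β - 1 := by linarith
    rw [sub_zero]
    positivity
  simpa using this

theorem setIntegral_sin_pow_div_le (n : ℕ) {A T β : ℝ} (hA : 0 < A) (hT : 0 < T) (hβ : 1 < β) :
    ∫ t in Icc 0 (π / 2), sin t ^ n / (A * cos t + T * sin t) ^ β ≤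
      2 ^ β * (π / 2 * A ^ (-β) + (β - 1)⁻¹ * A⁻¹ * T ^ (1 - β)) := by
  have hpi : 0 ≤ π / 2 := by positivity
  have hcont : ContinuousOn (fun t => (A * (π / 2 - t) + T) ^ (-β)) (uIcc 0 (π / 2)) :=
    ContinuousOn.rpow_const (by fun_prop) fun t ht => Or.inl (by
      rw [uIcc_of_le hpi] at ht
      have : 0 ≤ π / 2 - t := by linarith [ht.2]
      positivity)
  have hcont' : ContinuousOn (fun t => sin t ^ n / (A * cos t + T * sin t) ^ β)
      (uIcc 0 (π / 2)) := by
    rw [uIcc_of_le hpi]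
    refine ContinuousOn.div (by fun_prop) (ContinuousOn.rpow_const (by fun_prop) ?_) ?_
    · exact fun t ht => Or.inl (mul_cos_add_mul_sin_pos hA hT ht).ne'
    · exact fun t ht => (rpow_pos_of_pos (mul_cos_add_mul_sin_pos hA hT ht) β).ne'
  rw [integral_Icc_eq_integral_Ioc, ← intervalIntegral.integral_of_le hpi]
  calc ∫ t in (0 : ℝ)..π / 2, sin t ^ n / (A * cos t + T * sin t) ^ β
      ≤ ∫ t in (0 : ℝ)..π / 2, 2 ^ β * (A ^ (-β) + (A * (π / 2 - t) + T) ^ (-β)) := by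
        refine intervalIntegral.integral_mono_on hpi hcont'.intervalIntegrable
          (continuousOn_const.mul (continuousOn_const.add hcont)).intervalIntegrable
          fun t ht => ?_
        refine le_trans ?_ (inv_rpow_mul_cos_add_mul_sin_le hA hT (by linarith) ht)
        rw [div_eq_mul_inv]
        refine mul_le_of_le_one_left ?_ (pow_le_one₀ ?_ (sin_le_one t))
        · exact inv_nonneg.2 (rpow_nonneg (mul_cos_add_mul_sin_pos hA hT ht).le β)
        · exact sin_nonneg_of_mem_Icc_zero_pi_div_two ht
    _ = 2 ^ β * (π / 2 * A ^ (-β) +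
          ∫ t in (0 : ℝ)..π / 2, (A * (π / 2 - t) + T) ^ (-β)) := by
        rw [intervalIntegral.integral_const_mul, intervalIntegral.integral_add
          intervalIntegrable_const hcont.intervalIntegrable]
        simp
    _ ≤ _ := by
        gcongr
        exact integral_rpow_neg_le hA hT hβ

theorem S_succ_le (n : ℕ) {β : ℝ} (hβ : 1 < β) {a : Fin (n + 2) → ℝ} (ha : ∀ i, 0 < a i) :
    S (n + 1) β a ≤ 2 ^ β * (π / 2 * a 0 ^ (-β) * (∫ φ in octantBox n, sphereDensity n φ) +
      (β - 1)⁻¹ * (a 0)⁻¹ * S n (β - 1) (fun i => a i.succ)) := by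
  have ha' : ∀ i : Fin (n + 1), 0 < a i.succ := fun i => ha _
  obtain ⟨hint, hS⟩ := integrableOn_and_S_succ β ha
  have h1 := (integrableOn_sphereDensity n).const_mul (2 ^ β * (π / 2 * a 0 ^ (-β)))
  have h2 := (integrableOn_sphereDensity_div ha' (β - 1)).const_mul
    (2 ^ β * ((β - 1)⁻¹ * (a 0)⁻¹))
  calc S (n + 1) β a
      ≤ ∫ φ in octantBox n, (2 ^ β * (π / 2 * a 0 ^ (-β)) * sphereDensity n φ +
          2 ^ β * ((β - 1)⁻¹ * (a 0)⁻¹) *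
            (sphereDensity n φ / sphereForm n (fun i => a i.succ) φ ^ (β - 1))) := by
        rw [hS]
        refine setIntegral_mono_on hint (h1.add h2) (measurableSet_octantBox n) fun φ hφ => ?_
        have hT := sphereForm_pos ha' hφ
        rw [integral_const_mul]
        refine (mul_le_mul_of_nonneg_left (setIntegral_sin_pow_div_le n (ha 0) hT hβ)
          (sphereDensity_nonneg hφ)).trans_eq ?_
        rw [show 1 - β = -(β - 1) by ring, rpow_neg hT.le]
        ring
    _ = _ := by
        rw [integral_add h1 h2, integral_const_mul, integral_const_mul, ← S_eq]
        ring

/-- The induction step: for `n ≥ 2` (written as `m + 2`) and `β > 1` not equal to any of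
the integers `2, …, n`, the `n`-fold integral `S(β; a₁,…,a_{n+1})` is controlled by
`max {a₁⁻¹ a₂^{1-β}, a₁⁻¹ S(β-1; a₂,…,a_{n+1})}`, where the latter `S` is the analogous
`(n-1)`-fold integral in one dimension lower. -/
theorem S_induction_step (m : ℕ) (β : ℝ) (hβ : 1 < β)
    (hβne : ∀ j : ℕ, 2 ≤ j → j ≤ m + 2 → β ≠ (j : ℝ)) :
    ∃ C : ℝ, ∀ a : Fin (m+3) → ℝ, (∀ i, 0 < a i) → Antitone a →
      Real.sqrt 2 * a 1 ≤ a 0 →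
      S (m+2) β a ≤
        C * max ((a 0)⁻¹ * a 1 ^ (1 - β))
                ((a 0)⁻¹ * S (m+1) (β - 1) (fun i : Fin (m+2) => a i.succ)) := by
  have hW : 0 ≤ ∫ φ in octantBox (m + 1), sphereDensity (m + 1) φ :=
    setIntegral_nonneg (measurableSet_octantBox _) fun φ hφ => sphereDensity_nonneg hφ
  set W := ∫ φ in octantBox (m + 1), sphereDensity (m + 1) φ
  have hβ' : 0 < β - 1 := by linarith
  refine ⟨2 ^ β * (π / 2 * W + (β - 1)⁻¹), fun a ha hanti _ => ?_⟩
  refine (S_succ_le (m + 1) hβ ha).trans ?_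
  have hpow : a 0 ^ (-β) ≤ (a 0)⁻¹ * a 1 ^ (1 - β) := by
    rw [show -β = -1 + (1 - β) by ring, rpow_add (ha 0), rpow_neg_one]
    exact mul_le_mul_of_nonneg_left
      (rpow_le_rpow_of_nonpos (ha 1) (hanti (Fin.zero_le 1)) (by linarith))
      (inv_nonneg.2 (ha 0).le)
  set M := max ((a 0)⁻¹ * a 1 ^ (1 - β))
    ((a 0)⁻¹ * S (m + 1) (β - 1) (fun i : Fin (m + 2) => a i.succ))
  have hM₁ : a 0 ^ (-β) ≤ M := hpow.trans (le_max_left _ _)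
  have hM₂ : (a 0)⁻¹ * S (m + 1) (β - 1) (fun i : Fin (m + 2) => a i.succ) ≤ M := le_max_right _ _
  calc _ = 2 ^ β * (π / 2 * W * a 0 ^ (-β) + (β - 1)⁻¹ *
          ((a 0)⁻¹ * S (m + 1) (β - 1) (fun i : Fin (m + 2) => a i.succ))) := by ring
    _ ≤ 2 ^ β * (π / 2 * W * M + (β - 1)⁻¹ * M) := by gcongr
    _ = _ := by ring
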